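/- arXiv:2111.06954 — 4 statements merged into one kernel-verified Lean document; each statement's English description precedes it below -/
import Mathlib

section
/- Let A be an integrally closed domain (i.e., A is an integral domain that is integrally closed in its fraction field K), let L be an algebraic field extension of K, and let B be the integral closure of A in L. Then the polynomial ring B[T] is the integral closure of the polynomial ring A[T] inside the fraction field of B[T] (which is the rational function field L(T)); that is, B[T] is integral over A[T] and B[T] is integrally closed in its fraction field. -/
/-- Let `A` be an integrally closed domain with fraction field `K`,
let `L` be an algebraic field extension of `K` and `B` the integral closure of `A` in `L`.
Then `B[T]` is integral over `A[T]` and `B[T]` is integrally closed in its fraction field,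
i.e. `B[T]` is the integral closure of `A[T]` in `Frac(B[T]) = L(T)`. -/
theorem polynomial_integralClosure_of_algebraic
    (A K L : Type*) [CommRing A] [IsDomain A] [IsIntegrallyClosed A]
    [Field K] [Algebra A K] [IsFractionRing A K]
    [Field L] [Algebra K L] [Algebra A L] [IsScalarTower A K L]
    [Algebra.IsAlgebraic K L] :
    (Polynomial.mapRingHom (algebraMap A (integralClosure A L))).IsIntegral ∧
      IsIntegrallyClosed (Polynomial (integralClosure A L)) := by
  constructor
  · intro p
    let := (Polynomial.mapRingHom (algebraMap A (integralClosure A L))).toAlgebra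
    exact (Polynomial.isIntegral_iff_isIntegral_coeff (R := A)).mpr
      fun i => Algebra.IsIntegral.isIntegral (p.coeff i)
  · have : IsIntegrallyClosed (integralClosure A L) :=
      .of_isIntegrallyClosed_of_isIntegrallyClosedIn _ L
    infer_instance
end

section
/- Let A and B be commutative rings with an algebra structure A → B such that B is integral over A (every element of B is integral over A). Then the polynomial ring B[T] is integral over the polynomial ring A[T], i.e., every element of B[T] is integral over A[T]. -/
/-- If `B` is an `A`-algebra that is integral over `A`, then the polynomial
ring `B[T]` is integral over `A[T]` (via the map `A[T] → B[T]` induced by `algebraMap A B`). -/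
theorem polynomial_mapRingHom_isIntegral
    (A B : Type*) [CommRing A] [CommRing B] [Algebra A B]
    (h : ∀ b : B, IsIntegral A b) :
    (Polynomial.mapRingHom (algebraMap A B)).IsIntegral := by
  intro p
  exact Polynomial.isIntegral_iff_isIntegral_coeff.mpr fun n => h (p.coeff n)
end

section
/- Let C be a category with pullbacks and a terminal object X, and let J and K be Grothendieck topologies on C with J ≤ K (every J-covering sieve is a K-covering sieve). Let F be a presheaf of sets (or of abelian groups) on C that is a sheaf for the topology J. Suppose there exists a family of morphisms (U_i → X) generating a J-covering sieve of the terminal object X such that, for every i, the restriction of F along the forgetful functor C/U_i → C is a sheaf on the over-category C/U_i for the topology induced by K. Then F is a sheaf for the topology K on C. -/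
open CategoryTheory

/-- If the restriction of a presheaf `F` to `Over U` is a sheaf for the sieve on `Y` corresponding
to a sieve `S` on `Y.left`, then `F` is a sheaf for `S`. -/
theorem isSheafFor_of_isSheafFor_overEquiv_symm
    {C : Type*} [Category C] (F : Cᵒᵖ ⥤ Type*) {U : C} (Y : Over U) (S : Sieve Y.left)
    (h : Presieve.IsSheafFor ((Over.forget U).op ⋙ F) ((Sieve.overEquiv Y).symm S).arrows) :
    Presieve.IsSheafFor F S.arrows := by
  intro x hx
  let x' : Presieve.FamilyOfElements ((Over.forget U).op ⋙ F)
    ((Sieve.overEquiv Y).symm S).arrows := fun Z g hg => x g.left hg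
  have hx' : x'.Compatible := fun Z₁ Z₂ W g₁ g₂ f₁ f₂ h₁ h₂ w =>
    hx g₁.left g₂.left h₁ h₂ (by simpa using (Over.forget U).congr_map w)
  obtain ⟨t, ht, huniq⟩ := h x' hx'
  refine ⟨t, fun W g hg => ?_, fun t' ht' => huniq t' fun Z g hg => ht' g.left hg⟩
  exact ht (Over.homMk g : Over.mk (g ≫ Y.hom) ⟶ Y) hg

/-- Let `C` be a category with pullbacks and a terminal object `X`, and let
`J ≤ K` be Grothendieck topologies on `C`. If a `J`-sheaf of sets `F` admits a family of maps
`(Uᵢ ⟶ X)` generating a `J`-covering sieve of the terminal object `X` such that for every `i`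
the restriction of `F` to the over-category `C/Uᵢ` (along the forgetful functor) is a sheaf for
the topology on `C/Uᵢ` induced by `K`, then `F` is a `K`-sheaf. -/
theorem isSheaf_of_isSheaf_over_covering
    {C : Type*} [Category C] [Limits.HasPullbacks C]
    {X : C} (hX : Limits.IsTerminal X)
    (J K : GrothendieckTopology C) (hJK : J ≤ K)
    (F : Cᵒᵖ ⥤ Type*) (hF : Presieve.IsSheaf J F)
    {ι : Type*} (U : ι → C) (f : ∀ i, U i ⟶ X)
    (hcov : Sieve.generate (Presieve.ofArrows U f) ∈ J X)
    (hres : ∀ i, Presieve.IsSheaf (K.over (U i)) ((Over.forget (U i)).op ⋙ F)) :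
    Presieve.IsSheaf K F := by
  intro Y S hS
  let R := (Sieve.generate (Presieve.ofArrows U f)).pullback (hX.from Y)
  have hR : R ∈ J Y := J.pullback_stable _ hcov
  refine Presieve.isSheafFor_trans F R S (hF R hR)
    (fun Z g _ => (hF _ (J.pullback_stable g hR)).isSeparatedFor) fun Z g hg => ?_
  obtain ⟨_, a, _, ⟨i⟩, -⟩ := hg
  exact isSheafFor_of_isSheafFor_overEquiv_symm F (Over.mk a) (S.pullback g)
    (hres i _ (K.overEquiv_symm_mem_over (Over.mk a) _ (K.pullback_stable g hS)))
end

section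
/- Let X be a scheme whose underlying topological space is connected. Then the affine line A^1_X over X (the base change to X of the affine line, i.e., the fiber product X ×_{Spec ℤ} Spec ℤ[T], equivalently the affine space of dimension 1 over X) has connected underlying topological space. -/
open AlgebraicGeometry CategoryTheory

theorem AlgebraicGeometry.GeometricallyIrreducible.geometricallyConnected
    {X Y : Scheme} (f : X ⟶ Y) [GeometricallyIrreducible f] : GeometricallyConnected f where
  geometrically_connectedSpace _ _ y _ fst snd h :=
    have := GeometricallyIrreducible.geometrically_irreducibleSpace (f := f) y fst snd h
    inferInstance

/-- If `X` is a scheme with connected underlying topological space, then the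
affine line `𝔸¹_X = X ×_{Spec ℤ} Spec ℤ[T]` over `X` has connected underlying space. -/
theorem affineLine_connectedSpace (X : Scheme) [ConnectedSpace X] :
    ConnectedSpace (AffineSpace (Fin 1) X) := by
  have := GeometricallyIrreducible.geometricallyConnected (AffineSpace (Fin 1) X ↘ X)
  exact GeometricallyConnected.connectedSpace (AffineSpace (Fin 1) X ↘ X)
    (AffineSpace.isOpenMap_over X)
end
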